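/- For every d ≥ 0, the flag-vectors (W_S(L(Z)))_{S ⊆ [d]} of the lattices of flats L(Z) of (d+1)-dimensional zonotopes Z affinely span all flag-vectors of graded posets of rank d+1; that is, dim aff { (W_S(L(Z)))_{S ⊆ [d]} ∈ ℝ^{2^d} : Z a zonotope of dimension d+1 } = 2^d − 1 (the only linear relation being W_∅ = 1). -/

import Mathlib

open scoped BigOperators InnerProductSpace Pointwise

noncomputable section

/-- Euclidean space `ℝ^d`. -/
abbrev Euc (d : ℕ) : Type := EuclideanSpace ℝ (Fin d)

namespace GramAngles

variable {d : ℕ}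

/-- The conical (positive) hull of a set. -/
def posHull (S : Set (Euc d)) : Set (Euc d) :=
  {u | ∃ c : ℝ, ∃ p ∈ S, 0 ≤ c ∧ u = c • p}

/-- The dimension of a set: the rank of the linear subspace parallel to its affine hull. -/
def sdim (S : Set (Euc d)) : ℕ := Module.finrank ℝ (vectorSpan ℝ S)

/-- A polyhedral cone with apex at the origin: a finitely generated convex cone. -/
def IsPolyhedralCone (C : Set (Euc d)) : Prop :=
  ∃ (n : ℕ) (v : Fin n → Euc d),
    C = {x | ∃ c : Fin n → ℝ, (∀ i, 0 ≤ c i) ∧ x = ∑ i, c i • v i}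

/-- A cone angle on `ℝ^d`: a simple, normalized valuation on polyhedral cones. -/
structure ConeAngle (d : ℕ) where
  toFun : Set (Euc d) → ℝ
  zero' : toFun {0} = 0
  union' : ∀ C C' : Set (Euc d), IsPolyhedralCone C → IsPolyhedralCone C' →
    IsPolyhedralCone (C ∪ C') → IsPolyhedralCone (C ∩ C') →
    toFun (C ∪ C') = toFun C + toFun C' - toFun (C ∩ C')
  simple' : ∀ C : Set (Euc d), IsPolyhedralCone C → sdim C < d → toFun C = 0
  norm' : toFun Set.univ = 1

/-- A (convex) polytope: the convex hull of a nonempty finite point set. -/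
def IsPolytope (P : Set (Euc d)) : Prop :=
  ∃ s : Finset (Euc d), s.Nonempty ∧ P = convexHull ℝ (s : Set (Euc d))

/-- Faces of a polytope are its exposed subsets (including `∅` and `P` itself). -/
def IsFace (P F : Set (Euc d)) : Prop := IsExposed ℝ P F

open Classical in
/-- A chosen point in the relative interior of `F`. -/
def relPt (F : Set (Euc d)) : Euc d :=
  if h : (intrinsicInterior ℝ F).Nonempty then h.some else 0

/-- The tangent (inner) cone `T_F G = cone(-q + G) + L(G)^⊥`, `q ∈ relint F`. -/
def innerCone (F G : Set (Euc d)) : Set (Euc d) :=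
  posHull ((fun x => x - relPt F) '' G) + (((vectorSpan ℝ G)ᗮ : Submodule ℝ (Euc d)) : Set (Euc d))

/-- The normal cone `N_F G` of `G` at a face `F`. -/
def normalCone (F G : Set (Euc d)) : Set (Euc d) :=
  {c | ∀ x ∈ F, ∀ y ∈ G, ⟪c, y⟫_ℝ ≤ ⟪c, x⟫_ℝ}

/-- The outer cone `O_F G = N_F G + L(F)`. -/
def outerCone (F G : Set (Euc d)) : Set (Euc d) :=
  normalCone F G + ((vectorSpan ℝ F : Submodule ℝ (Euc d)) : Set (Euc d))

/-- Interior angle of `G` at its face `F`, measured by the cone angle `α`. -/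
def intAngle (α : ConeAngle d) (F G : Set (Euc d)) : ℝ := α.toFun (innerCone F G)

/-- Exterior angle of `G` at its face `F`, measured by the cone angle `α`. -/
def extAngle (α : ConeAngle d) (F G : Set (Euc d)) : ℝ := α.toFun (outerCone F G)

/-- `α̂_i(P)`: sum of interior angles over all `i`-dimensional (nonempty) faces of `P`. -/
def intAngleSum (α : ConeAngle d) (P : Set (Euc d)) (i : ℕ) : ℝ :=
  ∑ᶠ F ∈ {F : Set (Euc d) | IsFace P F ∧ F.Nonempty ∧ sdim F = i}, intAngle α F P

/-- `α̌_i(P)`: sum of exterior angles over all `i`-dimensional (nonempty) faces of `P`. -/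
def extAngleSum (α : ConeAngle d) (P : Set (Euc d)) (i : ℕ) : ℝ :=
  ∑ᶠ F ∈ {F : Set (Euc d) | IsFace P F ∧ F.Nonempty ∧ sdim F = i}, extAngle α F P

/-- A zonotope: a translate of a Minkowski sum of finitely many segments. -/
def IsZonotope (Z : Set (Euc d)) : Prop :=
  ∃ (t : Euc d) (n : ℕ) (z : Fin n → Euc d),
    Z = {x | ∃ l : Fin n → ℝ, (∀ i, |l i| ≤ 1) ∧ x = t + ∑ i, l i • z i}

/-- The face of `P` on which the linear functional `⟪c, ·⟫` is maximized. -/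
def maxFace (P : Set (Euc d)) (c : Euc d) : Set (Euc d) :=
  {x ∈ P | ∀ y ∈ P, ⟪c, y⟫_ℝ ≤ ⟪c, x⟫_ℝ}

/-- A belt polytope: a polytope whose normal fan is the fan induced by a central
hyperplane arrangement (two functionals maximize the same face iff they have the
same sign pattern with respect to the arrangement). -/
def IsBeltPolytope (P : Set (Euc d)) : Prop :=
  IsPolytope P ∧ ∃ (k : ℕ) (z : Fin k → Euc d), (∀ i, z i ≠ 0) ∧
    ∀ c c' : Euc d,
      ((∀ i, Real.sign ⟪z i, c⟫_ℝ = Real.sign ⟪z i, c'⟫_ℝ) ↔ maxFace P c = maxFace P c')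

/-- The set of flats of a polytope: linear subspaces parallel to nonempty faces,
ordered by inclusion (as a subtype of `Submodule ℝ (Euc d)`). -/
def Flats (P : Set (Euc d)) : Set (Submodule ℝ (Euc d)) :=
  {L | ∃ F : Set (Euc d), IsFace P F ∧ F.Nonempty ∧ L = vectorSpan ℝ F}

/-- Strictly increasing chains from `a` to `c` in a poset, encoded as lists. -/
def chainsFromTo {β : Type*} [Preorder β] (a c : β) : Set (List β) :=
  {l | l.Chain' (· < ·) ∧ l.head? = some a ∧ l.getLast? = some c}

/-- The Möbius function of a poset, via Philip Hall's chain formula. -/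
def mob {β : Type*} [Preorder β] (a c : β) : ℝ :=
  ∑ᶠ l ∈ chainsFromTo a c, (-1 : ℝ) ^ (l.length + 1)

/-- Whitney numbers of the first kind of a ranked poset with minimum `bot`. -/
def whitney1 {β : Type*} [Preorder β] (rk : β → ℕ) (bot : β) (i : ℕ) : ℝ :=
  ∑ᶠ a ∈ {a : β | rk a = i}, mob bot a

/-- Flag-Whitney numbers of the second kind: the number of chains with rank set `S`. -/
def flagW2 {β : Type*} [Preorder β] (rk : β → ℕ) (S : Finset ℕ) : ℕ :=
  Nat.card {l : List β // l.Chain' (· < ·) ∧ l.map rk = S.sort (· ≤ ·)}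

/-- Flag-Whitney numbers of the first kind:
`w_S = Σ μ(0̂,c₁) μ(c₁,c₂) ⋯ μ(c_{k-1},c_k)` over chains with rank set `S`. -/
def flagW1 {β : Type*} [Preorder β] (rk : β → ℕ) (bot : β) (S : Finset ℕ) : ℝ :=
  ∑ᶠ l ∈ {l : List β | l.Chain' (· < ·) ∧ l.map rk = S.sort (· ≤ ·)},
    (List.zipWith mob (bot :: l) l).prod

/-- Chains of nonempty faces of `P` whose dimensions are exactly the set `S`. -/
def faceChains (P : Set (Euc d)) (S : Finset ℕ) : Set (List (Set (Euc d))) :=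
  {l | (∀ F ∈ l, IsFace P F ∧ F.Nonempty) ∧ l.Chain' (· ⊂ ·) ∧ l.map sdim = S.sort (· ≤ ·)}

/-- The interior flag-angle `α̂_S(P) = Σ α̂(F₁,F₂) α̂(F₂,F₃) ⋯ α̂(F_k,P)`. -/
def intFlag (α : ConeAngle d) (P : Set (Euc d)) (S : Finset ℕ) : ℝ :=
  ∑ᶠ l ∈ faceChains P S, (List.zipWith (intAngle α) l (l.drop 1 ++ [P])).prod

/-- The exterior flag-angle `α̌_S(P) = Σ α̌(F₁,F₂) α̌(F₂,F₃) ⋯ α̌(F_k,P)`. -/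
def extFlag (α : ConeAngle d) (P : Set (Euc d)) (S : Finset ℕ) : ℝ :=
  ∑ᶠ l ∈ faceChains P S, (List.zipWith (extAngle α) l (l.drop 1 ++ [P])).prod

/-- Membership in the incidence algebra: vanishing off the order relation. -/
def memIA {β : Type*} [Preorder β] (h : β → β → ℝ) : Prop :=
  ∀ a c, ¬ a ≤ c → h a c = 0

/-- Convolution product of the incidence algebra. -/
def conv {β : Type*} [Preorder β] (g h : β → β → ℝ) (a c : β) : ℝ :=
  ∑ᶠ (b : β) (_ : a ≤ b ∧ b ≤ c), g a b * h b c

/-- The product `∗_k`, summing over middle elements of rank `k`. -/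
def convk {β : Type*} (rk : β → ℕ) (k : ℕ) (g h : β → β → ℝ) (a c : β) : ℝ :=
  ∑ᶠ (b : β) (_ : rk b = k), g a b * h b c

/-- The pushforward `φ_* h (q,q') = |φ⁻¹(q')|⁻¹ Σ_{p ∈ φ⁻¹(q), p' ∈ φ⁻¹(q')} h(p,p')`. -/
def pushf {β γ : Type*} (φ : β → γ) (h : β → β → ℝ) (q q' : γ) : ℝ :=
  (Nat.card {p : β // φ p = q'} : ℝ)⁻¹ *
    ∑ᶠ (p : β) (_ : φ p = q) (p' : β) (_ : φ p' = q'), h p p'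

/-- The subspace `I_φ(𝒫)`: elements whose fiberwise column sums are independent of
the representative of the target fiber. -/
def memIphi {β γ : Type*} [Preorder β] (φ : β → γ) (h : β → β → ℝ) : Prop :=
  memIA h ∧ ∀ (q : γ) (p₁ p₂ : β), φ p₁ = φ p₂ →
    (∑ᶠ (p : β) (_ : φ p = q), h p p₁) = (∑ᶠ (p : β) (_ : φ p = q), h p p₂)

open Classical in
/-- The pullback `φ^* g (p,p') = g(φ p, φ p')` for `p ≤ p'`, else `0`. -/
def pullb {β γ : Type*} [Preorder β] (φ : β → γ) (g : γ → γ → ℝ) (p p' : β) : ℝ :=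
  if p ≤ p' then g (φ p) (φ p') else 0

open Classical in
/-- The identity `δ` of the incidence algebra. -/
def deltaIA {β : Type*} (a c : β) : ℝ := if a = c then 1 else 0

end GramAngles

namespace GramAngles

section Comb
set_option linter.unusedSectionVars false
open Module

variable {V : Type*} [AddCommGroup V] [Module ℝ V] [FiniteDimensional ℝ V]

open Classical in
/-- The flats (spans of subsets) of a finite vector configuration. -/
def flatsOf (A : Finset V) : Finset (Submodule ℝ V) :=
  A.powerset.image (fun X => Submodule.span ℝ (X : Set V))

lemma mem_flatsOf {A : Finset V} {G : Submodule ℝ V} :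
    G ∈ flatsOf A ↔ ∃ X : Finset V, X ⊆ A ∧ Submodule.span ℝ (X : Set V) = G := by
  simp [flatsOf]

lemma bot_mem_flatsOf (A : Finset V) : (⊥ : Submodule ℝ V) ∈ flatsOf A :=
  mem_flatsOf.2 ⟨∅, by simp, by simp⟩

lemma span_mem_flatsOf (A : Finset V) : Submodule.span ℝ (A : Set V) ∈ flatsOf A :=
  mem_flatsOf.2 ⟨A, by simp, rfl⟩

lemma le_span_of_mem {A : Finset V} {G : Submodule ℝ V} (h : G ∈ flatsOf A) :
    G ≤ Submodule.span ℝ (A : Set V) := by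
  obtain ⟨X, hX, rfl⟩ := mem_flatsOf.1 h
  exact Submodule.span_mono (by exact_mod_cast hX)

lemma sup_mem_flatsOf {A : Finset V} {G H : Submodule ℝ V} (hG : G ∈ flatsOf A)
    (hH : H ∈ flatsOf A) : G ⊔ H ∈ flatsOf A := by
  classical
  obtain ⟨X, hX, rfl⟩ := mem_flatsOf.1 hG
  obtain ⟨Y, hY, rfl⟩ := mem_flatsOf.1 hH
  exact mem_flatsOf.2 ⟨X ∪ Y, Finset.union_subset hX hY, by
    rw [Finset.coe_union, Submodule.span_union]⟩

open Classical in
/-- Number of weak chains of flats above `G` with prescribed list of ranks. -/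
def cnt (A : Finset V) : List ℕ → Submodule ℝ V → ℕ
  | [], _ => 1
  | s :: l, G => ∑ G' ∈ (flatsOf A).filter (fun G' => G ≤ G' ∧ finrank ℝ G' = s), cnt A l G'

/-- The list of shifted rank lists. -/
def shifts : List ℕ → List (List ℕ)
  | [] => []
  | s :: l => (s :: l).map Nat.pred :: (shifts l).map (s :: ·)

/-- `x` avoids all flats of `A` of rank less than `r`. -/
def Gen (A : Finset V) (x : V) (r : ℕ) : Prop :=
  ∀ G ∈ flatsOf A, finrank ℝ G < r → x ∉ G

lemma mem_flatsOf_insert [DecidableEq V] {A : Finset V} {x : V} {G : Submodule ℝ V} :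
    G ∈ flatsOf (insert x A) ↔ G ∈ flatsOf A ∨ ∃ H ∈ flatsOf A, G = H ⊔ ℝ ∙ x := by
  constructor
  · intro h
    obtain ⟨X, hX, rfl⟩ := mem_flatsOf.1 h
    by_cases hx : x ∈ X
    · right
      refine ⟨_, mem_flatsOf.2 ⟨X.erase x, by grind, rfl⟩, ?_⟩
      rw [← Submodule.span_union]
      congr 1
      ext y; simp; grind
    · left
      exact mem_flatsOf.2 ⟨X, by grind, rfl⟩
  · rintro (h | ⟨H, h, rfl⟩)
    · obtain ⟨X, hX, rfl⟩ := mem_flatsOf.1 h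
      exact mem_flatsOf.2 ⟨X, by grind, rfl⟩
    · obtain ⟨X, hX, rfl⟩ := mem_flatsOf.1 h
      refine mem_flatsOf.2 ⟨insert x X, by grind, ?_⟩
      rw [Finset.coe_insert, Submodule.span_insert, sup_comm]

lemma finrank_sup_single {G : Submodule ℝ V} {x : V} (h : x ∉ G) :
    finrank ℝ (G ⊔ ℝ ∙ x : Submodule ℝ V) = finrank ℝ G + 1 := by
  have hx : x ≠ 0 := by rintro rfl; exact h G.zero_mem
  have h1 := Submodule.finrank_sup_add_finrank_inf_eq G (ℝ ∙ x)
  have h2 : G ⊓ (ℝ ∙ x) = ⊥ := by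
    rw [← disjoint_iff]
    exact (Submodule.disjoint_span_singleton' hx).2 h
  rw [h2, finrank_bot, finrank_span_singleton hx] at h1
  omega

lemma gen_le {A : Finset V} {x : V} {r : ℕ} (hg : Gen A x r) {G H : Submodule ℝ V}
    (hG : G ∈ flatsOf A) (hH : H ∈ flatsOf A) (hr : finrank ℝ (H ⊔ ℝ ∙ x : Submodule ℝ V) < r)
    (hle : G ≤ H ⊔ ℝ ∙ x) : G ≤ H := by
  have hs := sup_mem_flatsOf hG hH
  have h1 : G ⊔ H ≤ H ⊔ ℝ ∙ x := sup_le hle le_sup_left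
  have h2 : x ∉ G ⊔ H := hg _ hs (lt_of_le_of_lt (Submodule.finrank_mono h1) hr)
  have hxH : x ∉ H := fun h => h2 (le_sup_right (a := G) h)
  have h3 := finrank_sup_single hxH
  have h4 : finrank ℝ (G ⊔ H : Submodule ℝ V) < finrank ℝ (H ⊔ ℝ ∙ x : Submodule ℝ V) := by
    apply Submodule.finrank_lt_finrank_of_lt
    refine lt_of_le_of_ne h1 ?_
    intro he
    apply h2
    rw [he]
    exact le_sup_right (a := H) (Submodule.mem_span_singleton_self x)
  have h5 : H = G ⊔ H := Submodule.eq_of_le_of_finrank_le le_sup_right (by omega)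
  rw [h5]; exact le_sup_left

open Classical in
/-- Sum over the flats through `x`. -/
lemma sum_through {A : Finset V} {x : V} {r s : ℕ} (hg : Gen A x r) (hs : s < r) (h0 : 0 < s)
    {G : Submodule ℝ V} (hG : G ∈ flatsOf A) (f : Submodule ℝ V → ℕ) :
    ∑ G' ∈ (flatsOf (insert x A)).filter (fun G' => (G ≤ G' ∧ finrank ℝ G' = s) ∧ x ∈ G'), f G'
    = ∑ G' ∈ (flatsOf A).filter (fun G' => G ≤ G' ∧ finrank ℝ G' = s - 1), f (G' ⊔ ℝ ∙ x) := by
  symm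
  refine Finset.sum_bij (fun G' _ => G' ⊔ ℝ ∙ x) ?_ ?_ ?_ ?_
  · intro H hH
    simp only [Finset.mem_filter] at hH ⊢
    obtain ⟨hH, hle, hr⟩ := hH
    have hx : x ∉ H := hg _ hH (by omega)
    refine ⟨mem_flatsOf_insert.2 (Or.inr ⟨H, hH, rfl⟩), ⟨hle.trans le_sup_left, ?_⟩,
      le_sup_right (a := H) (Submodule.mem_span_singleton_self x)⟩
    rw [finrank_sup_single hx]; omega
  · intro H hH H' hH' he
    simp only [Finset.mem_filter] at hH hH' he
    have hx : x ∉ H := hg _ hH.1 (by omega)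
    have hx' : x ∉ H' := hg _ hH'.1 (by omega)
    apply le_antisymm
    · refine gen_le hg hH.1 hH'.1 ?_ (he ▸ le_sup_left)
      rw [finrank_sup_single hx']; omega
    · refine gen_le hg hH'.1 hH.1 ?_ (he ▸ le_sup_left)
      rw [finrank_sup_single hx]; omega
  · intro H hH
    simp only [Finset.mem_filter] at hH
    obtain ⟨hH, ⟨hle, hr⟩, hx⟩ := hH
    rcases mem_flatsOf_insert.1 hH with h | ⟨K, hK, rfl⟩
    · exact absurd hx (hg _ h (by omega))
    · refine ⟨K, ?_, rfl⟩
      have hxK : x ∉ K := hg _ hK (lt_of_le_of_lt (Submodule.finrank_mono le_sup_left) (hr ▸ hs))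
      have := finrank_sup_single hxK
      simp only [Finset.mem_filter]
      exact ⟨hK, gen_le hg hG hK (by omega) hle, by omega⟩
  · intros; rfl

open Classical in
lemma sum_avoid {A : Finset V} {x : V} {r s : ℕ} (hg : Gen A x r) (hs : s < r)
    {G : Submodule ℝ V} (f : Submodule ℝ V → ℕ) :
    ∑ G' ∈ (flatsOf (insert x A)).filter (fun G' => (G ≤ G' ∧ finrank ℝ G' = s) ∧ x ∉ G'), f G'
    = ∑ G' ∈ (flatsOf A).filter (fun G' => G ≤ G' ∧ finrank ℝ G' = s), f G' := by
  congr 1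
  ext H
  simp only [Finset.mem_filter]
  constructor
  · rintro ⟨h, h1, hx⟩
    rcases mem_flatsOf_insert.1 h with h | ⟨K, hK, rfl⟩
    · exact ⟨h, h1⟩
    · exact absurd (le_sup_right (a := K) (Submodule.mem_span_singleton_self x)) hx
  · rintro ⟨h, h1⟩
    exact ⟨mem_flatsOf_insert.2 (Or.inl h), h1, hg _ h (by omega)⟩

open Classical in
lemma cnt_above {A : Finset V} {x : V} {r : ℕ} (hg : Gen A x r) (l : List ℕ)
    (hl : ∀ s ∈ l, 0 < s ∧ s < r) {G : Submodule ℝ V} (hG : G ∈ flatsOf A) :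
    cnt (insert x A) l (G ⊔ ℝ ∙ x) = cnt A (l.map Nat.pred) G := by
  induction l generalizing G with
  | nil => rfl
  | cons s l ih =>
    simp only [cnt, List.map_cons]
    obtain ⟨h0, hs⟩ := hl s (by simp)
    have h := sum_through hg hs h0 hG (cnt (insert x A) l)
    have e : (flatsOf (insert x A)).filter (fun G' => G ⊔ ℝ ∙ x ≤ G' ∧ finrank ℝ G' = s) =
      (flatsOf (insert x A)).filter (fun G' => (G ≤ G' ∧ finrank ℝ G' = s) ∧ x ∈ G') := by
      ext H
      simp only [Finset.mem_filter, sup_le_iff, Submodule.span_singleton_le_iff_mem]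
      tauto
    rw [e, h]
    refine Finset.sum_congr rfl fun H hH => ?_
    simp only [Finset.mem_filter] at hH
    exact ih (fun t ht => hl t (by simp [ht])) hH.1

open Classical in
lemma cnt_insert {A : Finset V} {x : V} {r : ℕ} (hg : Gen A x r) (l : List ℕ)
    (hl : ∀ s ∈ l, 0 < s ∧ s < r) {G : Submodule ℝ V} (hG : G ∈ flatsOf A) :
    cnt (insert x A) l G = cnt A l G + ((shifts l).map (fun m => cnt A m G)).sum := by
  induction l generalizing G with
  | nil => rfl
  | cons s l ih =>
    obtain ⟨h0, hs⟩ := hl s (by simp)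
    have hl' : ∀ t ∈ l, 0 < t ∧ t < r := fun t ht => hl t (by simp [ht])
    have e : cnt (insert x A) (s :: l) G =
      ∑ G' ∈ (flatsOf A).filter (fun G' => G ≤ G' ∧ finrank ℝ G' = s), cnt (insert x A) l G' +
      ∑ G' ∈ (flatsOf A).filter (fun G' => G ≤ G' ∧ finrank ℝ G' = s - 1),
        cnt (insert x A) l (G' ⊔ ℝ ∙ x) := by
      rw [← sum_avoid hg hs, ← sum_through hg hs h0 hG, add_comm, cnt,
        ← Finset.sum_filter_add_sum_filter_not _ (fun G' => x ∈ G'), Finset.filter_filter,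
        Finset.filter_filter]
    rw [e]
    have e2 : ∑ G' ∈ (flatsOf A).filter (fun G' => G ≤ G' ∧ finrank ℝ G' = s - 1),
        cnt (insert x A) l (G' ⊔ ℝ ∙ x) = cnt A ((s :: l).map Nat.pred) G := by
      simp only [cnt, List.map_cons]
      refine Finset.sum_congr rfl fun H hH => ?_
      simp only [Finset.mem_filter] at hH
      exact cnt_above hg l hl' hH.1
    have e1 : ∑ G' ∈ (flatsOf A).filter (fun G' => G ≤ G' ∧ finrank ℝ G' = s),
        cnt (insert x A) l G' = cnt A (s :: l) G +
          ((shifts l).map (fun m => cnt A (s :: m) G)).sum := by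
      rw [Finset.sum_congr rfl (fun H hH => ih hl' (Finset.mem_filter.1 hH).1),
        Finset.sum_add_distrib]
      congr 1
      induction shifts l with
      | nil => simp
      | cons m L ihL => simp only [List.map_cons, List.sum_cons, Finset.sum_add_distrib, ihL]; rfl
    rw [e1, e2]
    simp only [shifts, List.map_cons, List.sum_cons, List.map_map, Function.comp_def]
    ring

lemma shifts_eq (l : List ℕ) (hl : l.Pairwise (· < ·)) :
    shifts l = l.map (fun j => l.map (fun s => if s < j then s else s - 1)) := by
  induction l with
  | nil => rfl
  | cons s l ih =>
    rw [List.pairwise_cons] at hl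
    rw [shifts, ih hl.2, List.map_cons, List.map_map]
    congr 1
    · show (s :: l).map Nat.pred = (s :: l).map (fun t => if t < s then t else t - 1)
      apply List.map_congr_left
      intro t ht
      rcases List.mem_cons.1 ht with rfl | ht
      · simp
      · have := hl.1 t ht
        simp [Nat.not_lt.2 this.le]
    · apply List.map_congr_left
      intro t ht
      simp [hl.1 t ht]

/-- Repeated ranks may be merged. -/
lemma cnt_dup (A : Finset V) (s : ℕ) (l : List ℕ) (G : Submodule ℝ V) :
    cnt A (s :: s :: l) G = cnt A (s :: l) G := by
  classical
  rw [cnt, cnt]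
  refine Finset.sum_congr rfl fun H hH => ?_
  rw [cnt]
  simp only [Finset.mem_filter] at hH
  have : (flatsOf A).filter (fun G' => H ≤ G' ∧ finrank ℝ G' = s) = {H} := by
    ext K
    simp only [Finset.mem_filter, Finset.mem_singleton]
    constructor
    · rintro ⟨_, h1, h2⟩
      exact (Submodule.eq_of_le_of_finrank_eq h1 (by omega)).symm
    · rintro rfl; exact ⟨hH.1, le_rfl, hH.2.2⟩
  rw [this, Finset.sum_singleton]

lemma cnt_dedup (A : Finset V) (l : List ℕ) (hl : l.Pairwise (· ≤ ·)) (G : Submodule ℝ V) :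
    cnt A l.dedup G = cnt A l G := by
  classical
  induction l generalizing G with
  | nil => rfl
  | cons s l ih =>
    rw [List.pairwise_cons] at hl
    by_cases h : s ∈ l
    · rw [List.dedup_cons_of_mem h, ih hl.2]
      cases l with
      | nil => simp at h
      | cons t l =>
        have : s = t := by
          rcases List.mem_cons.1 h with h | h
          · exact h
          · exact le_antisymm (hl.1 t (by simp)) ((List.pairwise_cons.1 hl.2).1 s h)
        subst this
        rw [cnt_dup]
    · rw [List.dedup_cons_of_notMem h, cnt, cnt]
      exact Finset.sum_congr rfl fun H _ => ih hl.2 H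

/-- The flag number as a function of finite sets. -/
def wS (A : Finset V) (S : Finset ℕ) : ℝ := cnt A (S.sort (· ≤ ·)) ⊥

lemma cnt_eq_wS (A : Finset V) (l : List ℕ) (hl : l.Pairwise (· ≤ ·)) :
    (cnt A l ⊥ : ℝ) = wS A l.toFinset := by
  rw [wS, ← cnt_dedup A l hl]
  congr 2
  have h : l.dedup.toFinset = l.toFinset := by ext; simp
  rw [← h]
  exact ((List.toFinset_sort (r := (· ≤ ·)) (List.nodup_dedup l)).2
    (hl.sublist (List.dedup_sublist l))).symm

/-- lowering from threshold `j` on -/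
def sh (j s : ℕ) : ℕ := if s < j then s else s - 1

lemma sh_mono {j s t : ℕ} (hj : 0 < j) (h : s ≤ t) : sh j s ≤ sh j t := by
  unfold sh; split_ifs <;> omega

open Classical in
lemma wS_insert {A : Finset V} {x : V} {r : ℕ} (hg : Gen A x r) (S : Finset ℕ)
    (hS : ∀ s ∈ S, 0 < s ∧ s < r) :
    wS (insert x A) S = wS A S + ∑ j ∈ S, wS A (S.image (sh j)) := by
  have hsorted : (S.sort (· ≤ ·)).Pairwise (· < ·) := by
    exact (Finset.sortedLT_sort S).pairwise
  rw [wS, cnt_insert hg _ (by simpa using hS) (bot_mem_flatsOf A), shifts_eq _ hsorted,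
    List.map_map]
  push_cast
  rw [List.map_map]
  congr 1
  have : ∑ j ∈ S, wS A (S.image (sh j)) =
      ((S.sort (· ≤ ·)).map (fun j => wS A (S.image (sh j)))).sum := by
    rw [← List.sum_toFinset _ (Finset.sort_nodup S (· ≤ ·)), Finset.sort_toFinset]
  rw [this]
  congr 1
  apply List.map_congr_left
  intro j hj
  rw [Finset.mem_sort] at hj
  simp only [Function.comp]
  rw [cnt_eq_wS]
  · congr 1
    ext t
    simp [sh]
  · rw [List.pairwise_map]
    refine hsorted.imp fun {a b} h => ?_
    exact sh_mono (hS j hj).1 h.le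

lemma wS_empty (A : Finset V) : wS A ∅ = 1 := by simp [wS, cnt]

lemma wS_insert_zero (A : Finset V) (S : Finset ℕ) : wS A (insert 0 S) = wS A S := by
  classical
  by_cases h : 0 ∈ S
  · rw [Finset.insert_eq_of_mem h]
  · rw [wS, Finset.sort_insert (r := (· ≤ ·)) (fun b _ => Nat.zero_le b) h, cnt]
    have : (flatsOf A).filter (fun G' : Submodule ℝ V => ⊥ ≤ G' ∧ finrank ℝ G' = 0) = {⊥} := by
      ext K
      simp only [Finset.mem_filter, Finset.mem_singleton, Submodule.finrank_eq_zero]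
      constructor
      · tauto
      · rintro rfl; simp [bot_mem_flatsOf]
    rw [this, Finset.sum_singleton, wS]

lemma cnt_top (A : Finset V) (l : List ℕ) {G : Submodule ℝ V} (hG : G ∈ flatsOf A) :
    cnt A (l ++ [finrank ℝ (Submodule.span ℝ (A : Set V))]) G = cnt A l G := by
  classical
  induction l generalizing G with
  | nil =>
    simp only [List.nil_append, cnt]
    rw [← Finset.card_eq_sum_ones, Finset.card_eq_one]
    refine ⟨Submodule.span ℝ (A : Set V), ?_⟩
    ext K
    simp only [Finset.mem_filter, Finset.mem_singleton]
    constructor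
    · rintro ⟨h, _, h2⟩
      exact Submodule.eq_of_le_of_finrank_eq (le_span_of_mem h) h2
    · rintro rfl
      exact ⟨span_mem_flatsOf A, le_span_of_mem hG, rfl⟩
  | cons s l ih =>
    rw [List.cons_append, cnt, cnt]
    exact Finset.sum_congr rfl fun H hH => ih (Finset.mem_filter.1 hH).1

lemma wS_insert_top (A : Finset V) (r : ℕ) (hr : finrank ℝ (Submodule.span ℝ (A : Set V)) = r)
    (S : Finset ℕ) (hS : ∀ s ∈ S, s ≤ r) :
    wS A (insert r S) = wS A S := by
  classical
  have h := cnt_top A (S.sort (· ≤ ·)) (bot_mem_flatsOf A)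
  rw [hr] at h
  rw [wS.eq_1 A S, ← h, cnt_eq_wS]
  · congr 1; ext; simp
  · rw [List.pairwise_append]
    refine ⟨Finset.pairwise_sort S _, by simp, ?_⟩
    simpa using hS

lemma exists_gen_in (A : Finset V) :
    ∃ x ∈ Submodule.span ℝ (A : Set V),
      Gen A x (finrank ℝ (Submodule.span ℝ (A : Set V))) := by
  classical
  by_contra! hcon
  set H := Submodule.span ℝ (A : Set V) with hH
  let I := {G : Submodule ℝ V // G ∈ flatsOf A ∧ finrank ℝ G < finrank ℝ H}
  have : Finite I := Finite.of_injective (β := flatsOf A) (fun G => ⟨G.1, G.2.1⟩) (by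
    intro a b h; exact Subtype.ext (congrArg (fun y => y.1) h))
  have hc : ⋃ i : I, ((i.1.comap H.subtype : Submodule ℝ H) : Set H) = Set.univ := by
    rw [Set.eq_univ_iff_forall]
    rintro ⟨x, hx⟩
    have := hcon x hx
    simp only [Gen, not_forall, not_not] at this
    obtain ⟨G, hG, hr, hxG⟩ := this
    exact Set.mem_iUnion.2 ⟨⟨G, hG, hr⟩, hxG⟩
  obtain ⟨⟨G, hG, hr⟩, hi⟩ := Subspace.exists_eq_top_of_iUnion_eq_univ hc
  have : H ≤ G := Submodule.comap_subtype_eq_top.1 hi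
  have := Submodule.finrank_mono this
  omega


lemma image_sh_insert {n : ℕ} {S : Finset ℕ} {j : ℕ} (hj : j ≤ n) :
    (insert (n + 1) S).image (sh j) = insert n (S.image (sh j)) := by
  rw [Finset.image_insert]
  congr 1
  simp [sh]; omega

lemma image_sh_last {n : ℕ} {S : Finset ℕ} (hS : ∀ s ∈ S, s ≤ n) :
    (insert (n + 1) S).image (sh (n + 1)) = insert n S := by
  rw [Finset.image_insert]
  congr 1
  · simp [sh]
  · ext t
    simp only [Finset.mem_image, sh]
    constructor
    · rintro ⟨a, ha, rfl⟩
      have := hS a ha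
      rw [if_pos (by omega)]; exact ha
    · intro h
      have := hS t h
      exact ⟨t, h, by rw [if_pos (by omega)]⟩

/-- The key injectivity statement. -/
lemma D_inj (n : ℕ) (w : Finset ℕ → ℝ) (h0 : ∀ S, w (insert 0 S) = w S)
    (h : ∀ S ⊆ Finset.Icc 1 n, ∑ j ∈ S, (w (S.image (sh j)) - w (insert n (S.image (sh j))))
      - w (insert n S) = 0) : ∀ S ⊆ Finset.Icc 1 n, w S = 0 := by
  induction n generalizing w with
  | zero =>
    intro S hS
    have : S = ∅ := by simpa using hS
    subst this
    have := h ∅ (by simp)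
    rw [h0] at this
    simpa using this
  | succ n ih =>
    let X : Finset ℕ → ℝ := fun S => w S - w (insert (n + 1) S)
    have hX0 : ∀ S, X (insert 0 S) = X S := by
      intro S
      simp only [X]
      rw [Finset.insert_comm, h0, h0]
    have hX : ∀ S ⊆ Finset.Icc 1 n, X S = 0 := by
      refine ih X hX0 ?_
      intro S hS
      have hle : ∀ s ∈ S, s ≤ n := fun s hs => (Finset.mem_Icc.1 (hS hs)).2
      have hn : n + 1 ∉ S := fun h => by have := hle _ h; omega
      have e1 := h S (hS.trans (Finset.Icc_subset_Icc_right (by omega)))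
      have e2 := h (insert (n + 1) S) (by
        intro t ht
        rcases Finset.mem_insert.1 ht with rfl | ht
        · simp
        · have := Finset.mem_Icc.1 (hS ht)
          simp; omega)
      rw [Finset.sum_insert hn, image_sh_last hle,
        Finset.sum_congr rfl (fun j hj => by rw [image_sh_insert (hle j hj)]),
        Finset.insert_idem] at e2
      change ∑ j ∈ S, (X (S.image (sh j)) - X (insert n (S.image (sh j)))) - X (insert n S) = 0
      change ∑ j ∈ S, X (S.image (sh j)) - _ = 0 at e1
      change X (insert n S) + ∑ j ∈ S, X (insert n (S.image (sh j))) - _ = 0 at e2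
      rw [Finset.sum_sub_distrib]
      linarith
    have hX' : ∀ T : Finset ℕ, (∀ t ∈ T, t ≤ n) → X T = 0 := by
      intro T hT
      have : X T = X (T.erase 0) := by
        by_cases h : 0 ∈ T
        · rw [← hX0 (T.erase 0), Finset.insert_erase h]
        · rw [Finset.erase_eq_of_notMem h]
      rw [this]
      apply hX
      intro t ht
      rw [Finset.mem_erase] at ht
      have := hT t ht.2
      simp; omega
    intro S hS
    have hle : ∀ s ∈ S.erase (n + 1), s ≤ n := by
      intro s hs
      rw [Finset.mem_erase] at hs
      have := Finset.mem_Icc.1 (hS hs.2)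
      omega
    have e1 := h (S.erase (n + 1)) ((Finset.erase_subset _ _).trans hS)
    change ∑ j ∈ _, X _ - _ = 0 at e1
    rw [Finset.sum_eq_zero] at e1
    · have e3 := hX' _ hle
      simp only [X] at e3
      by_cases hn : n + 1 ∈ S
      · rw [Finset.insert_erase hn] at e1
        linarith
      · rw [Finset.erase_eq_of_notMem hn] at e1 e3
        linarith
    · intro j hj
      apply hX'
      intro t ht
      obtain ⟨s, hs, rfl⟩ := Finset.mem_image.1 ht
      have := hle s hs
      unfold sh; split_ifs <;> omega

/-- Subsets of `Fin d` as subsets of `{1,…,d}`. -/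
def up (d : ℕ) (S : Finset (Fin d)) : Finset ℕ := S.image (fun i : Fin d => (i : ℕ) + 1)

/-- The trace of a set of naturals on `{1,…,d}`. -/
def dn (d : ℕ) (A : Finset ℕ) : Finset (Fin d) := Finset.univ.filter (fun i => (i : ℕ) + 1 ∈ A)

lemma mem_up {d : ℕ} {S : Finset (Fin d)} {n : ℕ} :
    n ∈ up d S ↔ ∃ i ∈ S, (i : ℕ) + 1 = n := by simp [up]

lemma mem_dn {d : ℕ} {A : Finset ℕ} {i : Fin d} : i ∈ dn d A ↔ (i : ℕ) + 1 ∈ A := by simp [dn]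

lemma dn_up (d : ℕ) (S : Finset (Fin d)) : dn d (up d S) = S := by
  ext i
  rw [mem_dn, mem_up]
  constructor
  · rintro ⟨j, hj, h⟩
    have : j = i := Fin.ext (by omega)
    exact this ▸ hj
  · intro h; exact ⟨i, h, rfl⟩

lemma up_bound {d : ℕ} {S : Finset (Fin d)} {n : ℕ} (h : n ∈ up d S) : 0 < n ∧ n < d + 1 := by
  obtain ⟨i, _, rfl⟩ := mem_up.1 h
  omega

lemma mem_up_dn {d : ℕ} {A : Finset ℕ} {n : ℕ} : n ∈ up d (dn d A) ↔ n ∈ A ∧ 0 < n ∧ n ≤ d := by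
  rw [mem_up]
  constructor
  · rintro ⟨i, hi, rfl⟩
    exact ⟨mem_dn.1 hi, by omega, by omega⟩
  · rintro ⟨h, h0, h1⟩
    exact ⟨⟨n - 1, by omega⟩, mem_dn.2 (by simpa [Nat.sub_add_cancel h0] using h), by simp; omega⟩

lemma dn_up_dn (d : ℕ) (A : Finset ℕ) : dn d (up (d + 1) (dn (d + 1) A)) = dn d A := by
  ext i
  rw [mem_dn, mem_up_dn, mem_dn]
  constructor
  · tauto
  · intro h; exact ⟨h, by omega, by omega⟩

lemma up_dn_of_subset {d : ℕ} {A : Finset ℕ} (h : A ⊆ Finset.Icc 1 d) : up d (dn d A) = A := by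
  ext n
  rw [mem_up_dn]
  constructor
  · tauto
  · intro hn
    have := Finset.mem_Icc.1 (h hn)
    exact ⟨hn, by omega, by omega⟩

/-- The shift operator. -/
def Uop (d : ℕ) : (Finset (Fin d) → ℝ) →ₗ[ℝ] (Finset (Fin d) → ℝ) where
  toFun v S := ∑ j ∈ up d S, v (dn d ((up d S).image (sh j)))
  map_add' v w := by ext S; simp [Finset.sum_add_distrib]
  map_smul' c v := by ext S; simp [Finset.mul_sum]

/-- Extension by the top rank. -/
def extOp (d : ℕ) : (Finset (Fin d) → ℝ) →ₗ[ℝ] (Finset (Fin (d + 1)) → ℝ) where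
  toFun v S := v (dn d (up (d + 1) S))
  map_add' v w := by ext S; simp
  map_smul' c v := by ext S; simp

lemma Uop_ext (d : ℕ) (v : Finset (Fin d) → ℝ) (B : Finset ℕ) (hB : B ⊆ Finset.Icc 1 (d + 1)) :
    Uop (d + 1) (extOp d v) (dn (d + 1) B) = ∑ j ∈ B, v (dn d (B.image (sh j))) := by
  simp only [Uop, extOp, LinearMap.coe_mk, AddHom.coe_mk]
  rw [up_dn_of_subset hB]
  simp only [dn_up_dn]

lemma one_add_U_inj (d : ℕ) : Function.Injective ((LinearMap.id : (Finset (Fin d) → ℝ) →ₗ[ℝ] _) + Uop d) := by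
  rw [← LinearMap.ker_eq_bot, LinearMap.ker_eq_bot']
  intro v hv
  have key : ∀ m : ℕ, ∀ S : Finset (Fin d), (∀ i ∈ S, (i : ℕ) < m) → v S = 0 := by
    intro m
    induction m with
    | zero =>
      intro S hS
      have : S = ∅ := Finset.eq_empty_of_forall_notMem fun i hi => by simpa using hS i hi
      subst this
      simpa [Uop, up] using congrFun hv ∅
    | succ m ih =>
      intro S hS
      have h := congrFun hv S
      simp only [LinearMap.add_apply, LinearMap.id_apply, Pi.add_apply, Pi.zero_apply, Uop,
        LinearMap.coe_mk, AddHom.coe_mk] at h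
      rw [Finset.sum_eq_zero] at h
      · simpa using h
      · intro j hj
        apply ih
        intro i hi
        rw [mem_dn, Finset.mem_image] at hi
        obtain ⟨s, hs, hsi⟩ := hi
        obtain ⟨a, ha, rfl⟩ := mem_up.1 hs
        obtain ⟨b, hb, rfl⟩ := mem_up.1 hj
        have h1 := hS a ha
        have h2 := hS b hb
        unfold sh at hsi
        split_ifs at hsi <;> omega
  ext S
  exact key d S (fun i _ => i.2)

/-- The difference operator. -/
def Dop (d : ℕ) : (Finset (Fin d) → ℝ) →ₗ[ℝ] (Finset (Fin d) → ℝ) where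
  toFun v S := Uop (d + 1) (extOp d v) (dn (d + 1) (up d S)) -
    Uop (d + 1) (extOp d v) (dn (d + 1) (insert (d + 1) (up d S)))
  map_add' v w := by ext S; simp; ring
  map_smul' c v := by ext S; simp; ring

lemma up_subset (d : ℕ) (S : Finset (Fin d)) : up d S ⊆ Finset.Icc 1 d := by
  intro n hn
  have := up_bound hn
  simp; omega

lemma up_subset' (d : ℕ) (S : Finset (Fin d)) : up d S ⊆ Finset.Icc 1 (d + 1) :=
  (up_subset d S).trans (Finset.Icc_subset_Icc_right (by omega))

lemma insert_up_subset (d : ℕ) (S : Finset (Fin d)) :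
    insert (d + 1) (up d S) ⊆ Finset.Icc 1 (d + 1) := by
  rw [Finset.insert_subset_iff]
  exact ⟨by simp, up_subset' d S⟩

lemma Dop_inj (d : ℕ) : Function.Injective (Dop d) := by
  rw [← LinearMap.ker_eq_bot, LinearMap.ker_eq_bot']
  intro v hv
  have key := D_inj d (fun A => v (dn d A)) (by
    intro S
    congr 1
    ext i
    simp [mem_dn]) (by
    intro S hS
    have hle : ∀ s ∈ S, s ≤ d := fun s hs => (Finset.mem_Icc.1 (hS hs)).2
    have hn : d + 1 ∉ S := fun h => by have := hle _ h; omega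
    have h := congrFun hv (dn d S)
    simp only [Dop, LinearMap.coe_mk, AddHom.coe_mk, Pi.zero_apply] at h
    rw [Uop_ext _ _ _ (up_subset' _ _), Uop_ext _ _ _ (insert_up_subset _ _),
      up_dn_of_subset hS, Finset.sum_insert hn, image_sh_last hle] at h
    have e : ∑ j ∈ S, v (dn d ((insert (d + 1) S).image (sh j))) =
        ∑ j ∈ S, v (dn d (insert d (S.image (sh j)))) :=
      Finset.sum_congr rfl (fun j hj => by rw [image_sh_insert (hle j hj)])
    rw [Finset.sum_sub_distrib]
    linarith)
  ext S
  have := key (up d S) (up_subset d S)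
  simpa [dn_up] using this

lemma exists_decomp (d : ℕ) (y : Finset (Fin (d + 1)) → ℝ) :
    ∃ v u : Finset (Fin d) → ℝ, y = Uop (d + 1) (extOp d v) + extOp d u := by
  obtain ⟨v, hv⟩ := (LinearMap.injective_iff_surjective.1 (Dop_inj d))
    (fun S => y (dn (d + 1) (up d S)) - y (dn (d + 1) (insert (d + 1) (up d S))))
  set z := y - Uop (d + 1) (extOp d v) with hz
  refine ⟨v, fun S => z (dn (d + 1) (up d S)), ?_⟩
  have hzz : ∀ S : Finset (Fin d),
      z (dn (d + 1) (up d S)) = z (dn (d + 1) (insert (d + 1) (up d S))) := by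
    intro S
    have := congrFun hv S
    simp only [Dop, LinearMap.coe_mk, AddHom.coe_mk] at this
    simp only [hz, Pi.sub_apply]
    linarith
  have : z = extOp d (fun S => z (dn (d + 1) (up d S))) := by
    ext S
    simp only [extOp, LinearMap.coe_mk, AddHom.coe_mk]
    by_cases h : d + 1 ∈ up (d + 1) S
    · rw [hzz]
      congr 1
      rw [← dn_up (d + 1) S]
      congr 1
      rw [dn_up]
      ext n
      rw [Finset.mem_insert, mem_up_dn]
      constructor
      · intro hn
        have := up_bound hn
        by_cases n = d + 1
        · tauto
        · right; exact ⟨hn, by omega, by omega⟩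
      · rintro (rfl | h') <;> tauto
    · congr 1
      rw [← dn_up (d + 1) S]
      congr 1
      rw [dn_up]
      ext n
      rw [mem_up_dn]
      constructor
      · intro hn
        have := up_bound hn
        have : n ≠ d + 1 := by rintro rfl; exact h hn
        exact ⟨hn, by omega, by omega⟩
      · tauto
  rw [← this, hz]
  abel

lemma wS_up_dn {d : ℕ} (A : Finset V) (B : Finset ℕ) (hB : ∀ b ∈ B, b ≤ d) :
    wS A (up d (dn d B)) = wS A B := by
  have : up d (dn d B) = B.erase 0 := by
    ext n
    rw [mem_up_dn, Finset.mem_erase]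
    constructor
    · rintro ⟨h, h1, _⟩; exact ⟨by omega, h⟩
    · rintro ⟨h, h1⟩; exact ⟨h1, by omega, hB n h1⟩
  rw [this]
  by_cases h : 0 ∈ B
  · rw [← wS_insert_zero A (B.erase 0), Finset.insert_erase h]
  · rw [Finset.erase_eq_of_notMem h]

/-- The flag vector of a vector configuration. -/
def fv (d : ℕ) (A : Finset V) : Finset (Fin d) → ℝ := fun S => wS A (up d S)

open Classical in
lemma fv_insert (d : ℕ) (A : Finset V) (x : V) (hg : Gen A x (d + 1)) :
    fv d (insert x A) = ((LinearMap.id : (Finset (Fin d) → ℝ) →ₗ[ℝ] _) + Uop d) (fv d A) := by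
  ext S
  simp only [fv, LinearMap.add_apply, LinearMap.id_apply, Pi.add_apply, Uop,
    LinearMap.coe_mk, AddHom.coe_mk]
  rw [wS_insert hg _ (fun s hs => up_bound hs)]
  congr 1
  refine Finset.sum_congr rfl fun j hj => ?_
  rw [wS_up_dn]
  intro b hb
  obtain ⟨s, hs, rfl⟩ := Finset.mem_image.1 hb
  have := up_bound hs
  unfold sh; split_ifs <;> omega

lemma fv_ext (d : ℕ) (A : Finset V) (hA : finrank ℝ (Submodule.span ℝ (A : Set V)) = d + 1) :
    fv (d + 1) A = extOp d (fv d A) := by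
  ext S
  simp only [fv, extOp, LinearMap.coe_mk, AddHom.coe_mk]
  have hb : ∀ s ∈ up d (dn d (up (d + 1) S)), s ≤ d + 1 := fun s hs => by
    have := up_bound hs; omega
  have e : ∀ n, n ∈ up (d + 1) S → n ≠ d + 1 → n ∈ up d (dn d (up (d + 1) S)) := by
    intro n hn hne
    have := up_bound hn
    rw [mem_up_dn]; exact ⟨hn, by omega, by omega⟩
  by_cases h : d + 1 ∈ up (d + 1) S
  · rw [← wS_insert_top A (d + 1) hA _ hb]
    congr 1
    ext n
    rw [Finset.mem_insert]
    constructor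
    · intro hn
      by_cases hne : n = d + 1
      · exact Or.inl hne
      · exact Or.inr (e n hn hne)
    · rintro (rfl | h')
      · exact h
      · exact (mem_up_dn.1 h').1
  · congr 1
    ext n
    constructor
    · intro hn
      exact e n hn (by rintro rfl; exact h hn)
    · intro hn; exact (mem_up_dn.1 hn).1

theorem span_fv (d : ℕ) (hd : d + 1 ≤ finrank ℝ V) :
    Submodule.span ℝ {v : Finset (Fin d) → ℝ | ∃ A : Finset V,
      finrank ℝ (Submodule.span ℝ (A : Set V)) = d + 1 ∧ v = fv d A} = ⊤ := by
  classical
  induction d with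
  | zero =>
    have : Nontrivial V := Module.nontrivial_of_finrank_pos (R := ℝ) (by omega)
    obtain ⟨x, hx⟩ := exists_ne (0 : V)
    rw [eq_top_iff]
    intro v _
    have h : fv 0 ({x} : Finset V) ∈ Submodule.span ℝ {v : Finset (Fin 0) → ℝ | ∃ A : Finset V,
      finrank ℝ (Submodule.span ℝ (A : Set V)) = 0 + 1 ∧ v = fv 0 A} := by
      apply Submodule.subset_span
      refine ⟨{x}, ?_, rfl⟩
      rw [Finset.coe_singleton, finrank_span_singleton hx]
    have e : v = v ∅ • fv 0 ({x} : Finset V) := by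
      ext S
      have : S = ∅ := Subsingleton.elim _ _
      subst this
      simp [fv, up, wS_empty]
    rw [e]
    exact Submodule.smul_mem _ _ h
  | succ d ih =>
    specialize ih (by omega)
    set P := Submodule.span ℝ {v : Finset (Fin (d + 1)) → ℝ | ∃ A : Finset V,
      finrank ℝ (Submodule.span ℝ (A : Set V)) = d + 1 + 1 ∧ v = fv (d + 1) A} with hP
    set T := (LinearMap.id : (Finset (Fin (d + 1)) → ℝ) →ₗ[ℝ] _) + Uop (d + 1) with hT
    have hTinj : Function.Injective T := one_add_U_inj (d + 1)
    have hle : P.map T ≤ P := by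
      rw [hP, Submodule.map_span_le]
      rintro _ ⟨A, hA, rfl⟩
      obtain ⟨x, hx, hg⟩ := exists_gen_in A
      rw [hA] at hg
      rw [hT, ← fv_insert _ A x hg]
      apply Submodule.subset_span
      refine ⟨_, ?_, rfl⟩
      rw [Finset.coe_insert, Submodule.span_insert_eq_span hx, hA]
    have heq : P.map T = P :=
      Submodule.eq_of_le_of_finrank_eq hle (LinearEquiv.finrank_eq (Submodule.equivMapOfInjective T hTinj P)).symm
    have h1 : ∀ v, extOp d v ∈ P := by
      intro v
      have hv : v ∈ (⊤ : Submodule ℝ (Finset (Fin d) → ℝ)) := trivial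
      rw [← ih] at hv
      suffices h : Submodule.span ℝ {v : Finset (Fin d) → ℝ | ∃ A : Finset V,
        finrank ℝ (Submodule.span ℝ (A : Set V)) = d + 1 ∧ v = fv d A} ≤ P.comap (extOp d) from
        h hv
      rw [Submodule.span_le]
      rintro _ ⟨A, hA, rfl⟩
      change extOp d (fv d A) ∈ P
      rw [← fv_ext d A hA]
      have hne : Submodule.span ℝ (A : Set V) ≠ ⊤ := by
        intro h
        rw [h, finrank_top] at hA
        omega
      obtain ⟨x, hx⟩ := SetLike.exists_not_mem_of_ne_top _ hne rfl
      have hg : Gen A x (d + 1 + 1) := fun G hG _ hxG => hx (le_span_of_mem hG hxG)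
      have hm : T (fv (d + 1) A) ∈ P := by
        rw [hT, ← fv_insert _ A x hg]
        apply Submodule.subset_span
        refine ⟨_, ?_, rfl⟩
        rw [Finset.coe_insert, Submodule.span_insert, sup_comm, finrank_sup_single hx, hA]
      rw [← heq] at hm
      obtain ⟨p, hp, hpe⟩ := hm
      exact hTinj hpe ▸ hp
    rw [eq_top_iff]
    intro y _
    obtain ⟨v, u, rfl⟩ := exists_decomp d y
    refine P.add_mem ?_ (h1 u)
    have h2 : T (extOp d v) ∈ P := hle ⟨_, h1 v, rfl⟩
    have h3 : Uop (d + 1) (extOp d v) = T (extOp d v) - extOp d v := by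
      rw [hT]; simp
    rw [h3]
    exact P.sub_mem h2 (h1 v)

end Comb

section Geom
open Module

variable {d : ℕ}

/-- The centered zonotope with given generators. -/
def zon {n : ℕ} (z : Fin n → Euc d) : Set (Euc d) :=
  {x | ∃ l : Fin n → ℝ, (∀ i, |l i| ≤ 1) ∧ x = 0 + ∑ i, l i • z i}

lemma zon_isZonotope {n : ℕ} (z : Fin n → Euc d) : IsZonotope (zon z) := ⟨0, n, z, rfl⟩

lemma abs_sign_le (a : ℝ) : |Real.sign a| ≤ 1 := by
  rcases Real.sign_apply_eq a with h | h | h <;> simp [h]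

lemma sign_mul_self' (a : ℝ) : Real.sign a * a = |a| := by
  rcases lt_trichotomy a 0 with h | h | h
  · rw [Real.sign_of_neg h, abs_of_neg h]; ring
  · simp [h]
  · rw [Real.sign_of_pos h, abs_of_pos h]; ring

/-- The face of a zonotope in the direction of a functional. -/
def zface {n : ℕ} (z : Fin n → Euc d) (f : StrongDual ℝ (Euc d)) : Set (Euc d) :=
  {x ∈ zon z | ∀ y ∈ zon z, f y ≤ f x}

lemma mul_le_abs_of {a b : ℝ} (h : |a| ≤ 1) : a * b ≤ |b| := by
  calc a * b ≤ |a * b| := le_abs_self _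
    _ = |a| * |b| := abs_mul _ _
    _ ≤ 1 * |b| := mul_le_mul_of_nonneg_right h (abs_nonneg _)
    _ = |b| := one_mul _

lemma mem_zface {n : ℕ} (z : Fin n → Euc d) (f : StrongDual ℝ (Euc d)) (x : Euc d) :
    x ∈ zface z f ↔ ∃ l : Fin n → ℝ, (∀ i, |l i| ≤ 1) ∧ (∀ i, l i * f (z i) = |f (z i)|) ∧
      x = ∑ i, l i • z i := by
  constructor
  · rintro ⟨⟨l, hl, rfl⟩, hmax⟩
    refine ⟨l, hl, ?_, by simp⟩
    have h := hmax (0 + ∑ i, Real.sign (f (z i)) • z i) ⟨_, fun i => abs_sign_le _, rfl⟩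
    simp only [zero_add, map_sum, map_smul, smul_eq_mul, sign_mul_self'] at h
    have h' : ∑ i, l i * f (z i) ≤ ∑ i, |f (z i)| :=
      Finset.sum_le_sum fun i _ => mul_le_abs_of (hl i)
    have := (Finset.sum_eq_sum_iff_of_le (fun i _ => mul_le_abs_of (b := f (z i)) (hl i))).1
      (le_antisymm h' h)
    intro i
    exact this i (Finset.mem_univ i)
  · rintro ⟨l, hl, he, rfl⟩
    refine ⟨⟨l, hl, by simp⟩, ?_⟩
    rintro _ ⟨l', hl', rfl⟩
    simp only [zero_add, map_sum, map_smul, smul_eq_mul, he]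
    exact Finset.sum_le_sum fun i _ => mul_le_abs_of (hl' i)

lemma zface_base {n : ℕ} (z : Fin n → Euc d) (f : StrongDual ℝ (Euc d)) :
    ∑ i, Real.sign (f (z i)) • z i ∈ zface z f :=
  (mem_zface z f _).2 ⟨_, fun _ => abs_sign_le _, fun _ => sign_mul_self' _, rfl⟩

lemma vectorSpan_zface {n : ℕ} (z : Fin n → Euc d) (f : StrongDual ℝ (Euc d)) :
    vectorSpan ℝ (zface z f) = Submodule.span ℝ {v | ∃ i, z i = v ∧ f v = 0} := by
  apply le_antisymm
  · rw [vectorSpan_def, Submodule.span_le]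
    rintro _ ⟨x, hx, y, hy, rfl⟩
    obtain ⟨l, hl, he, rfl⟩ := (mem_zface z f _).1 hx
    obtain ⟨l', hl', he', rfl⟩ := (mem_zface z f _).1 hy
    simp only [vsub_eq_sub, ← Finset.sum_sub_distrib, ← sub_smul]
    refine Submodule.sum_mem _ fun i _ => ?_
    by_cases h : f (z i) = 0
    · exact Submodule.smul_mem _ _ (Submodule.subset_span ⟨i, rfl, h⟩)
    · have : l i = l' i := mul_right_cancel₀ h ((he i).trans (he' i).symm)
      simp [this]
  · rw [Submodule.span_le]
    rintro _ ⟨i, rfl, hi⟩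
    have h1 := zface_base z f
    have h2 : ∑ j, (Real.sign (f (z j)) + if j = i then 1 else 0) • z j ∈ zface z f := by
      refine (mem_zface z f _).2 ⟨_, fun j => ?_, fun j => ?_, rfl⟩
      · by_cases h : j = i
        · subst h; simp [hi]
        · simp [h, abs_sign_le]
      · by_cases h : j = i
        · subst h; simp [hi]
        · simp [h, sign_mul_self']
    have := vsub_mem_vectorSpan ℝ h2 h1
    simpa [add_smul, Finset.sum_add_distrib] using this

lemma zface_isFace {n : ℕ} (z : Fin n → Euc d) (f : StrongDual ℝ (Euc d)) :
    IsFace (zon z) (zface z f) := fun _ => ⟨f, rfl⟩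

lemma flats_zon {n : ℕ} (z : Fin n → Euc d) (A : Finset (Euc d))
    (hz : ∀ v, (∃ i, z i = v) ↔ v ∈ A) (G : Submodule ℝ (Euc d)) :
    G ∈ Flats (zon z) ↔ G ∈ flatsOf A := by
  classical
  constructor
  · rintro ⟨F, hF, hne, rfl⟩
    obtain ⟨f, hf⟩ := hF hne
    change F = zface z f at hf
    rw [hf, vectorSpan_zface]
    refine mem_flatsOf.2 ⟨A.filter (fun v => f v = 0), Finset.filter_subset _ _, ?_⟩
    congr 1
    ext v
    simp only [Finset.coe_filter, Set.mem_setOf_eq, ← hz]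
    constructor
    · rintro ⟨⟨i, hi⟩, h⟩; exact ⟨i, hi, h⟩
    · rintro ⟨i, hi, h⟩; exact ⟨⟨i, hi⟩, h⟩
  · intro hG
    obtain ⟨X, hX, rfl⟩ := mem_flatsOf.1 hG
    set G := Submodule.span ℝ (X : Set (Euc d)) with hGdef
    obtain ⟨g, hg⟩ := Module.exists_dual_forall_apply_ne_zero (K := ℝ)
      (fun a : {a : Euc d // a ∈ A.filter (fun a => a ∉ G)} => G.mkQ a.1) (by
        rintro ⟨a, ha⟩
        simpa using (Finset.mem_filter.1 ha).2)
    let f : StrongDual ℝ (Euc d) := LinearMap.toContinuousLinearMap (g ∘ₗ G.mkQ)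
    have hf : ∀ v ∈ A, f v = 0 ↔ v ∈ G := by
      intro v hv
      constructor
      · intro h
        by_contra hvG
        exact hg ⟨v, Finset.mem_filter.2 ⟨hv, hvG⟩⟩ h
      · intro h
        have : G.mkQ v = 0 := by simpa using h
        simp [f, this]
    refine ⟨zface z f, zface_isFace z f, ⟨_, zface_base z f⟩, ?_⟩
    rw [vectorSpan_zface]
    apply le_antisymm
    · rw [hGdef, Submodule.span_le]
      intro x hx
      obtain ⟨i, hi⟩ := (hz x).2 (hX hx)
      exact Submodule.subset_span ⟨i, hi, (hf x (hX hx)).2 (Submodule.subset_span hx)⟩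
    · rw [Submodule.span_le]
      rintro v ⟨i, hi, h⟩
      exact (hf v ((hz v).1 ⟨i, hi⟩)).1 h

lemma sdim_zon {n : ℕ} (z : Fin n → Euc d) (A : Finset (Euc d))
    (hz : ∀ v, (∃ i, z i = v) ↔ v ∈ A) :
    sdim (zon z) = finrank ℝ (Submodule.span ℝ (A : Set (Euc d))) := by
  have h : zface z 0 = zon z := by simp [zface]
  rw [sdim, ← h, vectorSpan_zface]
  have e : {v | ∃ i, z i = v ∧ (0 : StrongDual ℝ (Euc d)) v = 0} = (A : Set (Euc d)) := by
    ext v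
    simp [hz]
  rw [e]

/-- Chains of members of `F` above `G` with rank list `l`. -/
abbrev ChainsAbove (F : Set (Submodule ℝ (Euc d))) (l : List ℕ) (G : Submodule ℝ (Euc d)) :=
  {c : List F // List.IsChain (· ≤ ·) (G :: c.map Subtype.val) ∧
    c.map (fun L : F => finrank ℝ L.1) = l}

open Classical in
/-- Splitting off the first member of a chain. -/
def chainsEquiv (F : Set (Submodule ℝ (Euc d))) (A : Finset (Euc d))
    (hF : ∀ G, G ∈ F ↔ G ∈ flatsOf A) (s : ℕ) (l : List ℕ) (G : Submodule ℝ (Euc d)) :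
    ChainsAbove F (s :: l) G ≃
      Σ G' : {G' // G' ∈ (flatsOf A).filter (fun G' => G ≤ G' ∧ finrank ℝ G' = s)},
        ChainsAbove F l G'.1 where
  toFun c := match c with
    | ⟨[], h⟩ => absurd h.2 (by simp)
    | ⟨K :: c, h⟩ => ⟨⟨K.1, Finset.mem_filter.2 ⟨(hF _).1 K.2, by
        have h1 := h.1
        have h2 := h.2
        simp only [List.map_cons, List.isChain_cons_cons, List.cons.injEq] at h1 h2
        exact ⟨h1.1, h2.1⟩⟩⟩, ⟨c, by
        have h1 := h.1
        have h2 := h.2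
        simp only [List.map_cons, List.isChain_cons_cons, List.cons.injEq] at h1 h2
        exact ⟨h1.2, h2.2⟩⟩⟩
  invFun p := ⟨⟨p.1.1, (hF _).2 (Finset.mem_filter.1 p.1.2).1⟩ :: p.2.1, by
    have h := (Finset.mem_filter.1 p.1.2).2
    simp only [List.map_cons, List.isChain_cons_cons, List.cons.injEq]
    exact ⟨⟨h.1, p.2.2.1⟩, h.2, p.2.2.2⟩⟩
  left_inv c := by
    match c with
    | ⟨[], h⟩ => exact absurd h.2 (by simp)
    | ⟨K :: c, h⟩ => rfl
  right_inv p := rfl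

lemma card_chains (F : Set (Submodule ℝ (Euc d))) (A : Finset (Euc d))
    (hF : ∀ G, G ∈ F ↔ G ∈ flatsOf A) (l : List ℕ) (G : Submodule ℝ (Euc d)) :
    Finite (ChainsAbove F l G) ∧ Nat.card (ChainsAbove F l G) = cnt A l G := by
  classical
  induction l generalizing G with
  | nil =>
    have hu : Unique (ChainsAbove F [] G) :=
      { default := ⟨[], by simp⟩
        uniq := by
          rintro ⟨c, h⟩
          have := h.2
          simp only [List.map_eq_nil_iff] at this
          subst this
          rfl }
    exact ⟨inferInstance, by rw [Nat.card_unique]; rfl⟩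
  | cons s l ih =>
    have : ∀ G' : {G' // G' ∈ (flatsOf A).filter (fun G' => G ≤ G' ∧ finrank ℝ G' = s)},
        Finite (ChainsAbove F l G'.1) := fun G' => (ih G'.1).1
    have e := chainsEquiv F A hF s l G
    refine ⟨Finite.of_equiv _ e.symm, ?_⟩
    rw [Nat.card_congr e, Nat.card_sigma, cnt]
    simp only [(ih _).2]
    exact Finset.sum_coe_sort _ (cnt A l)

lemma flagW2_eq (F : Set (Submodule ℝ (Euc d))) (A : Finset (Euc d))
    (hF : ∀ G, G ∈ F ↔ G ∈ flatsOf A) (S : Finset ℕ) :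
    (flagW2 (fun L : F => finrank ℝ L.1) S : ℝ) = wS A S := by
  rw [flagW2, wS, ← (card_chains F A hF _ ⊥).2]
  congr 1
  refine Nat.card_congr (Equiv.subtypeEquivRight fun c => ?_)
  refine and_congr_left fun hc => ?_
  have hs : (S.sort (· ≤ ·)).Pairwise (· < ·) := (Finset.sortedLT_sort S).pairwise
  rw [← hc, List.pairwise_map] at hs
  rw [List.isChain_iff_pairwise]
  change List.IsChain (· < ·) c ↔ _
  rw [List.isChain_iff_pairwise, List.pairwise_cons, List.pairwise_map]
  constructor
  · intro h
    exact ⟨fun _ _ => bot_le, h.imp fun h => h.le⟩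
  · rintro ⟨_, h⟩
    refine (h.and hs).imp ?_
    rintro a b ⟨h1, h2⟩
    refine lt_of_le_of_ne h1 ?_
    rintro rfl
    exact lt_irrefl _ h2

lemma flagW2_empty {β : Type*} [Preorder β] (rk : β → ℕ) : flagW2 rk ∅ = 1 := by
  rw [flagW2]
  have hu : Unique {l : List β // l.Chain' (· < ·) ∧ l.map rk = (∅ : Finset ℕ).sort (· ≤ ·)} :=
    { default := ⟨[], List.IsChain.nil, by simp⟩
      uniq := by
        rintro ⟨c, h⟩
        have := h.2
        simp only [Finset.sort_empty, List.map_eq_nil_iff] at this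
        subst this
        rfl }
  exact Nat.card_unique

/-- Affine dimension from linear span. -/
lemma finrank_direction_of_span {ι : Type*} [Fintype ι] (s : Set (ι → ℝ)) (i₀ : ι)
    (h1 : ∀ v ∈ s, v i₀ = 1) (hs : Submodule.span ℝ s = ⊤) :
    finrank ℝ (affineSpan ℝ s).direction = Fintype.card ι - 1 := by
  classical
  rw [direction_affineSpan]
  have hne : s.Nonempty := by
    rw [Set.nonempty_iff_ne_empty]
    rintro rfl
    rw [Submodule.span_empty] at hs
    have : (fun _ => 1 : ι → ℝ) ∈ (⊥ : Submodule ℝ (ι → ℝ)) := hs ▸ trivial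
    have := congrFun ((Submodule.mem_bot ℝ).1 this) i₀
    simp at this
  obtain ⟨v₀, hv₀⟩ := hne
  have hnot : v₀ ∉ vectorSpan ℝ s := by
    intro h
    have hle : vectorSpan ℝ s ≤ LinearMap.ker (LinearMap.proj i₀ : (ι → ℝ) →ₗ[ℝ] ℝ) := by
      rw [vectorSpan_def, Submodule.span_le]
      rintro _ ⟨x, hx, y, hy, rfl⟩
      simp [h1 x hx, h1 y hy]
    have := hle h
    simp [h1 v₀ hv₀] at this
  have htop : vectorSpan ℝ s ⊔ ℝ ∙ v₀ = ⊤ := by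
    rw [eq_top_iff, ← hs, Submodule.span_le]
    intro v hv
    have e : v = (v - v₀) + v₀ := by abel
    rw [e]
    exact Submodule.add_mem_sup (vsub_mem_vectorSpan ℝ hv hv₀)
      (Submodule.mem_span_singleton_self v₀)
  have := finrank_sup_single hnot
  rw [htop, finrank_top, Module.finrank_fintype_fun_eq_card] at this
  omega

end Geom

/-- Theorem 6.1: flag-vectors of lattices of flats of zonotopes span.
For every `d ≥ 0`, the flag-vectors `(W_S(L(Z)))_{S ⊆ [d]}` of lattices of flats of
`(d+1)`-dimensional zonotopes affinely span a space of dimension `2^d - 1` (the only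
linear relation being `W_∅ = 1`). Subsets `S ⊆ [d] = {1,…,d}` are encoded by
`Finset (Fin d)` via `i ↦ i + 1`. -/
theorem statement19 (d : ℕ) :
    Module.finrank ℝ (affineSpan ℝ
      {v : Finset (Fin d) → ℝ | ∃ Z : Set (Euc (d + 1)),
        IsZonotope Z ∧ sdim Z = d + 1 ∧
        v = fun S => (flagW2 (fun L : ↥(Flats Z) => Module.finrank ℝ L.1)
          (S.image (fun i : Fin d => (i : ℕ) + 1)) : ℝ)}).direction = 2 ^ d - 1 := by
  rw [finrank_direction_of_span _ (∅ : Finset (Fin d))]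
  · simp
  · rintro v ⟨Z, _, _, rfl⟩
    simp [flagW2_empty]
  · rw [eq_top_iff, ← span_fv (V := Euc (d + 1)) d (by simp)]
    apply Submodule.span_mono
    rintro v ⟨A, hA, rfl⟩
    have hz : ∀ v, (∃ i, (fun i => (A.equivFin.symm i : Euc (d + 1))) i = v) ↔ v ∈ A := by
      intro v
      constructor
      · rintro ⟨i, rfl⟩; exact (A.equivFin.symm i).2
      · intro h; exact ⟨A.equivFin ⟨v, h⟩, by simp⟩
    refine ⟨zon (fun i => (A.equivFin.symm i : Euc (d + 1))), zon_isZonotope _, ?_, ?_⟩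
    · rw [sdim_zon _ A hz, hA]
    · funext S
      exact (flagW2_eq _ A (flats_zon _ A hz) _).symm

end GramAngles
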